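/- arXiv:0812.3919 — 2 statements merged into one kernel-verified Lean document; each statement's English description precedes it below -/
import Mathlib

section
/- For every e ∈ ℂ ∖ [−1,1], the denominator 1 − φ(e)·φ(z) is nonzero for all z ∈ ℂ ∖ [−1,1]; the function r(e;z) := (φ(z) − φ(e))/(1 − φ(e)·φ(z)) is holomorphic on ℂ ∖ [−1,1] and vanishes exactly at z = e; and for every x ∈ (−1,1) the one-sided limits r⁺(e;x) := lim_{z→x, Im z>0} r(e;z) and r⁻(e;x) := lim_{z→x, Im z<0} r(e;z) exist and satisfy r⁺(e;x)·r⁻(e;x) = 1. -/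
open Complex Set Filter Topology Bornology

/-- The segment `[-1,1]` regarded as a subset of `ℂ`. -/
noncomputable def seg : Set ℂ := (fun x : ℝ => (x : ℂ)) '' Set.Icc (-1) 1

/-- `w(z) = z (1 - z⁻²)^{1/2}`, principal branch of the square root. -/
noncomputable def wfun (z : ℂ) : ℂ := z * (1 - z⁻¹ ^ 2) ^ ((1 : ℂ) / 2)

/-- `φ(z) = z + w(z)`, the inverse Joukovski map. -/
noncomputable def phi (z : ℂ) : ℂ := z + wfun z

/-- `r(e; z) = (φ(z) - φ(e)) / (1 - φ(e) φ(z))`. -/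
noncomputable def rfn (e z : ℂ) : ℂ := (phi z - phi e) / (1 - phi e * phi z)

theorem mem_compl_seg_of_im_ne_zero {z : ℂ} (hz : z.im ≠ 0) : z ∈ segᶜ := by
  rintro ⟨x, -, rfl⟩
  simp at hz

theorem ne_zero_of_mem_compl_seg {z : ℂ} (hz : z ∈ segᶜ) : z ≠ 0 := by
  rintro rfl
  exact hz ⟨0, by norm_num, by simp⟩

theorem one_sub_inv_sq_mem_slitPlane {z : ℂ} (hz : z ∈ segᶜ) :
    1 - z⁻¹ ^ 2 ∈ slitPlane := by
  by_contra h
  apply hz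
  obtain ⟨u, rfl⟩ : ∃ u : ℂ, u⁻¹ = z := ⟨z⁻¹, inv_inv z⟩
  rw [mem_slitPlane_iff, not_or, not_lt, not_not] at h
  simp only [inv_inv, sq, sub_re, sub_im, one_re, one_im, mul_re, mul_im] at h
  obtain ⟨hre, him⟩ := h
  have hi : u.im = 0 := by
    have h0 : u.re * u.im = 0 := by linarith
    rcases mul_eq_zero.1 h0 with h1 | h1
    · rw [h1] at hre
      nlinarith [mul_self_nonneg u.im]
    · exact h1
  rw [hi] at hre
  have habs : |u.re⁻¹| ≤ 1 := by
    rw [abs_inv]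
    apply inv_le_one_of_one_le₀
    rw [← one_le_sq_iff_one_le_abs]
    nlinarith
  refine ⟨u.re⁻¹, abs_le.1 habs, ?_⟩
  have hu : u = (u.re : ℂ) := Complex.ext (by simp) (by simp [hi])
  rw [hu]
  simp

theorem re_cpow_half_pos {v : ℂ} (hv : v ∈ slitPlane) : 0 < (v ^ ((1 : ℂ) / 2)).re := by
  rw [cpow_def_of_ne_zero (slitPlane_ne_zero hv), exp_re]
  apply mul_pos (Real.exp_pos _)
  have him : (log v * (1 / 2)).im = v.arg / 2 := by
    simp [log_im, div_eq_mul_inv]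
  rw [him]
  have h1 := neg_pi_lt_arg v
  have h2 := lt_of_le_of_ne (arg_le_pi v) (mem_slitPlane_iff_arg.1 hv).1
  exact Real.cos_pos_of_mem_Ioo ⟨by linarith, by linarith⟩

theorem cpow_half_sq (v : ℂ) : (v ^ ((1 : ℂ) / 2)) ^ 2 = v := by
  simp

theorem wfun_sq {z : ℂ} (hz : z ≠ 0) : wfun z ^ 2 = z ^ 2 - 1 := by
  rw [wfun, mul_pow, cpow_half_sq]
  field_simp

theorem phi_mul_sub_wfun {z : ℂ} (hz : z ≠ 0) : phi z * (z - wfun z) = 1 := by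
  rw [phi]
  linear_combination -wfun_sq hz

theorem inv_phi {z : ℂ} (hz : z ≠ 0) : (phi z)⁻¹ = z - wfun z :=
  inv_eq_of_mul_eq_one_right (phi_mul_sub_wfun hz)

theorem one_lt_norm_phi {z : ℂ} (hz : z ∈ segᶜ) : 1 < ‖phi z‖ := by
  have hz0 := ne_zero_of_mem_compl_seg hz
  have hs := re_cpow_half_pos (one_sub_inv_sq_mem_slitPlane hz)
  have hlt : ‖z - wfun z‖ < ‖phi z‖ := by
    rw [phi, wfun]
    set s := (1 - z⁻¹ ^ 2) ^ ((1 : ℂ) / 2)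
    rw [show z - z * s = z * (1 - s) by ring, show z + z * s = z * (1 + s) by ring,
      norm_mul, norm_mul]
    apply mul_lt_mul_of_pos_left _ (norm_pos_iff.2 hz0)
    apply lt_of_pow_lt_pow_left₀ 2 (norm_nonneg _)
    rw [← normSq_eq_norm_sq, ← normSq_eq_norm_sq, normSq_apply, normSq_apply]
    simp only [sub_re, sub_im, add_re, add_im, one_re, one_im]
    nlinarith
  have hmul : ‖phi z‖ * ‖z - wfun z‖ = 1 := by
    rw [← norm_mul, phi_mul_sub_wfun hz0, norm_one]
  nlinarith [norm_nonneg (z - wfun z)]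

theorem phi_injOn : InjOn phi segᶜ := by
  intro z hz e he h
  have h1 := inv_phi (ne_zero_of_mem_compl_seg hz)
  have h2 := inv_phi (ne_zero_of_mem_compl_seg he)
  rw [h, h2] at h1
  rw [phi, phi] at h
  linear_combination (h - h1) / 2

theorem one_sub_mul_ne_zero_of_norm {a b : ℂ} (ha : 1 < ‖a‖) (hb : 1 ≤ ‖b‖) :
    1 - a * b ≠ 0 := by
  intro h
  have h1 : ‖a‖ * ‖b‖ = 1 := by
    rw [← norm_mul, ← sub_eq_zero.1 h, norm_one]
  nlinarith

theorem differentiableOn_phi : DifferentiableOn ℂ phi segᶜ := by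
  intro z hz
  have hz0 := ne_zero_of_mem_compl_seg hz
  have h : DifferentiableAt ℂ (fun z : ℂ => 1 - z⁻¹ ^ 2) z :=
    (differentiableAt_const _).sub ((differentiableAt_inv hz0).pow 2)
  exact (differentiableAt_id.add (differentiableAt_id.mul
    (h.cpow (differentiableAt_const _)
      (one_sub_inv_sq_mem_slitPlane hz)))).differentiableWithinAt

theorem wfun_im_pos {z : ℂ} (hz : 0 < z.im) : 0 < (wfun z).im := by
  have hseg := mem_compl_seg_of_im_ne_zero hz.ne'
  have hinv := inv_phi (ne_zero_of_mem_compl_seg hseg)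
  have hn : 1 < normSq (phi z) := by
    rw [normSq_eq_norm_sq]
    exact one_lt_pow₀ (one_lt_norm_phi hseg) two_ne_zero
  have him := congrArg Complex.im hinv
  rw [inv_im, sub_im, div_eq_iff (by linarith)] at him
  have hphi : (phi z).im = z.im + (wfun z).im := rfl
  rw [hphi] at him
  nlinarith

theorem wfun_eq_of_im_pos {z : ℂ} (hz : 0 < z.im) :
    wfun z = I * (1 - z ^ 2) ^ ((1 : ℂ) / 2) := by
  have hz0 := ne_zero_of_mem_compl_seg (mem_compl_seg_of_im_ne_zero hz.ne')
  have hre : 0 < (-I * wfun z).re := by simpa using wfun_im_pos hz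
  have hsq : (-I * wfun z) ^ 2 = 1 - z ^ 2 := by
    rw [mul_pow, wfun_sq hz0, neg_sq, I_sq]
    ring
  rw [← hsq, one_div, sq_cpow_two_inv hre, ← mul_assoc]
  simp

theorem wfun_neg (z : ℂ) : wfun (-z) = -wfun z := by
  simp [wfun, inv_neg]

theorem wfun_eq_of_im_neg {z : ℂ} (hz : z.im < 0) :
    wfun z = -(I * (1 - z ^ 2) ^ ((1 : ℂ) / 2)) := by
  have h := wfun_eq_of_im_pos (z := -z) (by simpa using hz)
  rw [wfun_neg, neg_sq] at h
  rw [← h, neg_neg]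

theorem continuousAt_cpow_half_one_sub_sq {x : ℝ} (hx : x ∈ Ioo (-1 : ℝ) 1) :
    ContinuousAt (fun z : ℂ => (1 - z ^ 2) ^ ((1 : ℂ) / 2)) x := by
  apply ContinuousAt.cpow (by fun_prop) continuousAt_const
  left
  rw [← ofReal_pow, sub_re, one_re, ofReal_re]
  nlinarith [hx.1, hx.2]

theorem tendsto_phi_upper {x : ℝ} (hx : x ∈ Ioo (-1 : ℝ) 1) :
    Tendsto phi (𝓝[{z : ℂ | 0 < z.im}] (x : ℂ))
      (𝓝 (x + I * (1 - (x : ℂ) ^ 2) ^ ((1 : ℂ) / 2))) := by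
  have h : ContinuousAt (fun z : ℂ => z + I * (1 - z ^ 2) ^ ((1 : ℂ) / 2)) x :=
    continuousAt_id.add (continuousAt_const.mul (continuousAt_cpow_half_one_sub_sq hx))
  refine (h.tendsto.mono_left nhdsWithin_le_nhds).congr' ?_
  filter_upwards [self_mem_nhdsWithin] with z hz
  rw [phi, wfun_eq_of_im_pos hz]

theorem tendsto_phi_lower {x : ℝ} (hx : x ∈ Ioo (-1 : ℝ) 1) :
    Tendsto phi (𝓝[{z : ℂ | z.im < 0}] (x : ℂ))
      (𝓝 (x + -(I * (1 - (x : ℂ) ^ 2) ^ ((1 : ℂ) / 2)))) := by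
  have h : ContinuousAt (fun z : ℂ => z + -(I * (1 - z ^ 2) ^ ((1 : ℂ) / 2))) x :=
    continuousAt_id.add (continuousAt_const.mul (continuousAt_cpow_half_one_sub_sq hx)).neg
  refine (h.tendsto.mono_left nhdsWithin_le_nhds).congr' ?_
  filter_upwards [self_mem_nhdsWithin] with z hz
  rw [phi, wfun_eq_of_im_neg hz]

theorem tendsto_rfn {e p : ℂ} {l : Filter ℂ} (hp : 1 - phi e * p ≠ 0)
    (h : Tendsto phi l (𝓝 p)) :
    Tendsto (rfn e) l (𝓝 ((p - phi e) / (1 - phi e * p))) :=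
  (h.sub_const _).div (tendsto_const_nhds.sub (h.const_mul _)) hp

/-- The boundary values of `phi` from above and below are mutually inverse. -/
theorem boundary_mul_eq_one (x : ℂ) :
    (x + I * (1 - x ^ 2) ^ ((1 : ℂ) / 2)) * (x + -(I * (1 - x ^ 2) ^ ((1 : ℂ) / 2))) = 1 := by
  linear_combination cpow_half_sq (1 - x ^ 2)
    - ((1 - x ^ 2) ^ ((1 : ℂ) / 2)) ^ 2 * I_sq

theorem stmt_2 (e : ℂ) (he : e ∈ segᶜ) :
    (∀ z ∈ segᶜ, 1 - phi e * phi z ≠ 0) ∧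
    DifferentiableOn ℂ (rfn e) segᶜ ∧
    (∀ z ∈ segᶜ, (rfn e z = 0 ↔ z = e)) ∧
    ∀ x : ℝ, x ∈ Set.Ioo (-1 : ℝ) 1 →
      ∃ rp rm : ℂ,
        Tendsto (rfn e) (𝓝[{z : ℂ | 0 < z.im}] (x : ℂ)) (𝓝 rp) ∧
        Tendsto (rfn e) (𝓝[{z : ℂ | z.im < 0}] (x : ℂ)) (𝓝 rm) ∧
        rp * rm = 1 := by
  have hphie := one_lt_norm_phi he
  have hden : ∀ z ∈ segᶜ, 1 - phi e * phi z ≠ 0 := fun z hz =>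
    one_sub_mul_ne_zero_of_norm hphie (one_lt_norm_phi hz).le
  refine ⟨hden, ?_, ?_, ?_⟩
  · exact (differentiableOn_phi.sub_const _).div
      ((differentiableOn_const _).sub (differentiableOn_phi.const_mul _)) hden
  · intro z hz
    rw [rfn, div_eq_zero_iff, or_iff_left (hden z hz), sub_eq_zero]
    exact phi_injOn.eq_iff hz he
  · intro x hx
    have hup := tendsto_phi_upper hx
    have hlow := tendsto_phi_lower hx
    have hmul := boundary_mul_eq_one (x : ℂ)
    set p := (x : ℂ) + I * (1 - (x : ℂ) ^ 2) ^ ((1 : ℂ) / 2)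
    set q := (x : ℂ) + -(I * (1 - (x : ℂ) ^ 2) ^ ((1 : ℂ) / 2))
    have hp1 : 1 ≤ ‖p‖ := by
      have : (𝓝[{z : ℂ | 0 < z.im}] (x : ℂ)).NeBot := by
        rw [← mem_closure_iff_nhdsWithin_neBot, closure_setOfPred_lt_im]
        simp
      refine ge_of_tendsto hup.norm ?_
      filter_upwards [self_mem_nhdsWithin] with z hz
      exact (one_lt_norm_phi (mem_compl_seg_of_im_ne_zero (ne_of_gt hz))).le
    have hq1 : 1 ≤ ‖q‖ := by
      have : (𝓝[{z : ℂ | z.im < 0}] (x : ℂ)).NeBot := by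
        rw [← mem_closure_iff_nhdsWithin_neBot, closure_setOfPred_im_lt]
        simp
      refine ge_of_tendsto hlow.norm ?_
      filter_upwards [self_mem_nhdsWithin] with z hz
      exact (one_lt_norm_phi (mem_compl_seg_of_im_ne_zero (ne_of_lt hz))).le
    have hp := one_sub_mul_ne_zero_of_norm hphie hp1
    have hq := one_sub_mul_ne_zero_of_norm hphie hq1
    refine ⟨_, _, tendsto_rfn hp hup, tendsto_rfn hq hlow, ?_⟩
    rw [div_mul_div_comm, div_eq_one_iff_eq (mul_ne_zero hp hq)]
    linear_combination (1 - phi e ^ 2) * hmul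
end

section
/- Let U ⊆ ℂ be open with [−1,1] ⊂ U, let p : U → ℂ be holomorphic and injective with p(−1) = −1 and p(1) = 1, and set F := p([−1,1]) (an analytic Jordan arc with endpoints ±1). Then ℂ ∖ F is open and connected, and there exists exactly one holomorphic function w : ℂ ∖ F → ℂ such that w(z)² = z² − 1 for every z ∈ ℂ ∖ F and w(z)/z → 1 as z → ∞. -/
open Complex Set Filter Topology Bornology

theorem isCompact_seg : IsCompact seg :=
  isCompact_Icc.image continuous_ofReal

theorem neg_one_mem_seg : (-1 : ℂ) ∈ seg := ⟨-1, by norm_num, by simp⟩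

theorem one_mem_seg : (1 : ℂ) ∈ seg := ⟨1, by norm_num, by simp⟩

theorem cosh_re_add_im_mul_I (s : ℂ) :
    cosh s = (Real.cosh s.re * Real.cos s.im : ℝ) + (Real.sinh s.re * Real.sin s.im : ℝ) * I := by
  conv_lhs => rw [← re_add_im s, cosh_add, cosh_mul_I, sinh_mul_I]
  push_cast
  ring

theorem cosh_mem_seg_of_re_eq_zero {s : ℂ} (hs : s.re = 0) : cosh s ∈ seg := by
  refine ⟨Real.cos s.im, ⟨Real.neg_one_le_cos _, Real.cos_le_one _⟩, ?_⟩
  rw [cosh_re_add_im_mul_I, hs]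
  simp

theorem cosh_notMem_seg_of_re_pos {s : ℂ} (hs : 0 < s.re) : cosh s ∉ seg := by
  rintro ⟨t, ht, h⟩
  rw [cosh_re_add_im_mul_I] at h
  have him := congrArg Complex.im h
  have hre := congrArg Complex.re h
  simp only [ofReal_re, ofReal_im, add_re, add_im, mul_re, mul_im, I_re, I_im] at him hre
  have hsinh : Real.sinh s.re ≠ 0 := (Real.sinh_pos_iff.2 hs).ne'
  have hsin : Real.sin s.im = 0 := by
    have : Real.sinh s.re * Real.sin s.im = 0 := by linarith
    exact (mul_eq_zero.1 this).resolve_left hsinh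
  have hcosh : 1 < Real.cosh s.re := Real.one_lt_cosh.2 hs.ne'
  have hcos : Real.cos s.im ^ 2 = 1 := by
    have := Real.sin_sq_add_cos_sq s.im
    rw [hsin] at this
    linarith
  have ht2 : t ^ 2 ≤ 1 := by nlinarith [ht.1, ht.2]
  have : t ^ 2 = Real.cosh s.re ^ 2 := by
    have : t = Real.cosh s.re * Real.cos s.im := by linarith
    rw [this, mul_pow, hcos, mul_one]
  nlinarith

theorem exists_cosh_eq_of_mem_seg {z : ℂ} (hz : z ∈ seg) : ∃ s : ℂ, s.re = 0 ∧ cosh s = z := by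
  obtain ⟨t, ht, rfl⟩ := hz
  refine ⟨Real.arccos t * I, by simp, ?_⟩
  rw [cosh_mul_I, ← ofReal_cos, Real.cos_arccos ht.1 ht.2]

/-- A thin vertical strip around the imaginary axis is mapped by `cosh` close to `[-1,1]`. -/
theorem exists_strip_cosh_mem {U : Set ℂ} (hU : IsOpen U) (hsub : seg ⊆ U) :
    ∃ ρ > 0, ∀ s : ℂ, |s.re| < ρ → cosh s ∈ U := by
  obtain ⟨δ, hδ, hδU⟩ := isCompact_seg.exists_thickening_subset_open hU hsub
  have hcont : Continuous fun x : ℝ => |Real.cosh x - 1| + |Real.sinh x| := by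
    have := Real.continuous_cosh
    have := Real.continuous_sinh
    fun_prop
  obtain ⟨ρ, hρ, h⟩ := Metric.continuousAt_iff.1 (hcont.continuousAt (x := 0)) δ hδ
  refine ⟨ρ, hρ, fun s hs => hδU (Metric.mem_thickening_iff.2 ⟨Real.cos s.im,
    ⟨_, ⟨Real.neg_one_le_cos _, Real.cos_le_one _⟩, rfl⟩, ?_⟩)⟩
  have hb := h (x := s.re) (by simpa [Real.dist_eq] using hs)
  rw [Real.dist_eq] at hb
  simp only [Real.cosh_zero, Real.sinh_zero, sub_self, abs_zero, add_zero, sub_zero] at hb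
  refine lt_of_le_of_lt ?_ ((le_abs_self _).trans_lt hb)
  rw [dist_eq, cosh_re_add_im_mul_I]
  have : ((Real.cosh s.re * Real.cos s.im : ℝ) : ℂ) + (Real.sinh s.re * Real.sin s.im : ℝ) * I
      - Real.cos s.im = ((Real.cosh s.re - 1) * Real.cos s.im : ℝ)
        + (Real.sinh s.re * Real.sin s.im : ℝ) * I := by
    push_cast
    ring
  rw [this]
  refine (norm_add_le _ _).trans (add_le_add ?_ ?_)
  · rw [norm_real, Real.norm_eq_abs, abs_mul]
    exact mul_le_of_le_one_right (abs_nonneg _) (Real.abs_cos_le_one _)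
  · rw [norm_mul, norm_I, mul_one, norm_real, Real.norm_eq_abs, abs_mul]
    exact mul_le_of_le_one_right (abs_nonneg _) (Real.abs_sin_le_one _)

/-- If a nonempty closed set `F` in a connected space has an open neighbourhood `G` with `G \ F`
contained in a preconnected subset of `Fᶜ`, then `Fᶜ` is preconnected. -/
theorem isPreconnected_compl_of_nhds {X : Type*} [TopologicalSpace X] [PreconnectedSpace X]
    {F G A : Set X} (hF : IsClosed F) (hne : F.Nonempty) (hG : IsOpen G) (hFG : F ⊆ G)
    (hA : IsPreconnected A) (hAF : A ⊆ Fᶜ) (hGA : G \ F ⊆ A) : IsPreconnected Fᶜ := by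
  have key : ∀ u v : Set X, IsOpen u → IsOpen v → Fᶜ ⊆ u ∪ v → Fᶜ ∩ (u ∩ v) = ∅ → A ⊆ u →
      Fᶜ ⊆ u := by
    intro u v hu hv huv hd hAu
    have hd' : ∀ x, x ∉ F → x ∈ u → x ∈ v → False := fun x h₁ h₂ h₃ =>
      (hd ▸ (⟨h₁, h₂, h₃⟩ : x ∈ Fᶜ ∩ (u ∩ v)) : x ∈ (∅ : Set X))
    have hclopen : univ ⊆ v ∩ Fᶜ ∨ univ ⊆ (u ∩ Fᶜ) ∪ G := by
      refine isPreconnected_iff_subset_of_disjoint.1 isPreconnected_univ _ _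
        (hv.inter hF.isOpen_compl) ((hu.inter hF.isOpen_compl).union hG) ?_ ?_
      · intro x _
        by_cases hx : x ∈ F
        · exact Or.inr (Or.inr (hFG hx))
        · rcases huv hx with h | h
          · exact Or.inr (Or.inl ⟨h, hx⟩)
          · exact Or.inl ⟨h, hx⟩
      · refine eq_empty_of_forall_notMem ?_
        rintro x ⟨-, ⟨hxv, hxF⟩, ⟨hxu, -⟩ | hxG⟩
        · exact hd' x hxF hxu hxv
        · exact hd' x hxF (hAu (hGA ⟨hxG, hxF⟩)) hxv
    rcases hclopen with h | h
    · obtain ⟨x, hx⟩ := hne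
      exact absurd hx (h (mem_univ x)).2
    · intro x hx
      rcases h (mem_univ x) with h' | h'
      · exact h'.1
      · exact hAu (hGA ⟨h', hx⟩)
  refine isPreconnected_iff_subset_of_disjoint.2 fun u v hu hv huv hd => ?_
  have hAd : A ∩ (u ∩ v) = ∅ := subset_empty_iff.1 (hd ▸ inter_subset_inter_left _ hAF)
  rcases isPreconnected_iff_subset_of_disjoint.1 hA u v hu hv (hAF.trans huv) hAd with h | h
  · exact Or.inl (key u v hu hv huv hd h)
  · exact Or.inr (key v u hv hu (by rwa [union_comm]) (by rwa [inter_comm v u]) h)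

/-- An analytic Jordan arc does not separate the plane. -/
theorem isConnected_compl_image_seg {U : Set ℂ} (hU : IsOpen U) (hsub : seg ⊆ U) {p : ℂ → ℂ}
    (hp : DifferentiableOn ℂ p U) (hinj : InjOn p U) : IsConnected (p '' seg)ᶜ := by
  obtain ⟨ρ, hρ, hstrip⟩ := exists_strip_cosh_mem hU hsub
  have hclosed : IsClosed (p '' seg) :=
    (isCompact_seg.image_of_continuousOn (hp.continuousOn.mono hsub)).isClosed
  set S : Set ℂ := re ⁻¹' Ioo (-ρ) ρ with hS
  have hSopen : IsOpen S := isOpen_Ioo.preimage continuous_re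
  have hSpre : IsPreconnected S :=
    ((convex_Ioo (-ρ) ρ).linear_preimage reLm).isPreconnected
  have hSU : ∀ s ∈ S, cosh s ∈ U := fun s hs => hstrip s (abs_lt.2 hs)
  have hT : IsPreconnected (re ⁻¹' Ioo 0 ρ) :=
    ((convex_Ioo 0 ρ).linear_preimage reLm).isPreconnected
  have hTS : re ⁻¹' Ioo 0 ρ ⊆ S := fun s hs => ⟨by linarith [hs.1], hs.2⟩
  have hdiff : DifferentiableOn ℂ (fun s => p (cosh s)) S :=
    hp.comp differentiable_cosh.differentiableOn hSU
  have hopen : IsOpen ((fun s => p (cosh s)) '' S) := by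
    rcases (hdiff.analyticOnNhd hSopen).is_constant_or_isOpen hSpre with ⟨c, hc⟩ | h
    · exfalso
      obtain ⟨a, ha, hae⟩ := exists_cosh_eq_of_mem_seg neg_one_mem_seg
      obtain ⟨b, hb, hbe⟩ := exists_cosh_eq_of_mem_seg one_mem_seg
      have h₁ := hc a (by simp [hS, ha, hρ])
      have h₂ := hc b (by simp [hS, hb, hρ])
      rw [hae] at h₁
      rw [hbe] at h₂
      have := hinj (hsub neg_one_mem_seg) (hsub one_mem_seg) (h₁.trans h₂.symm)
      norm_num at this
    · exact h S subset_rfl hSopen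
  have hAF : (fun s => p (cosh s)) '' (re ⁻¹' Ioo 0 ρ) ⊆ (p '' seg)ᶜ := by
    rintro _ ⟨s, hs, rfl⟩ ⟨x, hx, hxe⟩
    have := hinj (hsub hx) (hSU s (hTS hs)) hxe
    exact cosh_notMem_seg_of_re_pos hs.1 (this ▸ hx)
  refine ⟨⟨_, hAF ⟨(ρ / 2 : ℝ), ?_, rfl⟩⟩, ?_⟩
  · simp only [mem_preimage, ofReal_re, mem_Ioo]
    constructor <;> linarith
  refine isPreconnected_compl_of_nhds hclosed ⟨_, mem_image_of_mem p one_mem_seg⟩ hopen ?_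
    (hT.image _ (hdiff.continuousOn.mono hTS)) hAF ?_
  · rintro _ ⟨x, hx, rfl⟩
    obtain ⟨s, hs, rfl⟩ := exists_cosh_eq_of_mem_seg hx
    exact ⟨s, by simp [hS, hs, hρ], rfl⟩
  · rintro _ ⟨⟨s, hs, rfl⟩, hsF⟩
    rcases lt_trichotomy s.re 0 with h | h | h
    · exact ⟨-s, ⟨by simpa using h, by simpa using neg_lt.1 hs.1⟩, by simp⟩
    · exact absurd (mem_image_of_mem p (cosh_mem_seg_of_re_eq_zero h)) hsF
    · exact ⟨s, ⟨h, hs.2⟩, rfl⟩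

/-- The Cauchy integral along a path is a logarithm of the ratio of the endpoints seen from `z`. -/
theorem exp_integral_div_sub {γ g : ℝ → ℂ} {a b : ℝ} (hab : a ≤ b)
    (hγ : ∀ t ∈ Icc a b, HasDerivAt γ (g t) t) (hg : ContinuousOn g (Icc a b)) {z : ℂ}
    (hz : ∀ t ∈ Icc a b, γ t ≠ z) :
    (γ a - z) * exp (∫ t in a..b, g t / (γ t - z)) = γ b - z := by
  have hcont : ContinuousOn (fun t => g t / (γ t - z)) (Icc a b) :=
    hg.div (fun t ht => ((hγ t ht).continuousAt.sub continuousAt_const).continuousWithinAt)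
      fun t ht => sub_ne_zero.2 (hz t ht)
  set f : ℝ → ℂ := IccExtend hab ((Icc a b).domRestrict fun t => g t / (γ t - z)) with hf
  have hfc : Continuous f := hcont.domRestrict.Icc_extend'
  have hfe : ∀ t ∈ Icc a b, f t = g t / (γ t - z) := fun t ht => by
    rw [hf, IccExtend_of_mem _ _ ht, domRestrict_apply]
  have hintegral : ∫ t in a..b, g t / (γ t - z) = ∫ t in a..b, f t :=
    intervalIntegral.integral_congr fun t ht => (hfe t (by rwa [uIcc_of_le hab] at ht)).symm
  have hderiv : ∀ t ∈ Icc a b,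
      HasDerivAt (fun t => (γ t - z) * exp (-∫ u in a..t, f u)) 0 t := by
    intro t ht
    have h := ((hγ t ht).sub_const z).mul
      (hfc.integral_hasStrictDerivAt a t).hasDerivAt.neg.cexp
    refine h.congr_deriv ?_
    rw [hfe t ht]
    have := sub_ne_zero.2 (hz t ht)
    field_simp
    ring
  have hconst := constant_of_has_deriv_right_zero
    (fun t ht => (hderiv t ht).continuousAt.continuousWithinAt)
    (fun t ht => (hderiv t ⟨ht.1, ht.2.le⟩).hasDerivWithinAt) b (right_mem_Icc.2 hab)
  simp only [intervalIntegral.integral_same, neg_zero, exp_zero, mul_one] at hconst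
  rw [hintegral, ← hconst, mul_assoc, ← exp_add]
  simp

theorem differentiableOn_integral_div_sub {γ g : ℝ → ℂ} {a b : ℝ} (hab : a ≤ b)
    (hγ : ContinuousOn γ (Icc a b)) (hg : ContinuousOn g (Icc a b)) :
    DifferentiableOn ℂ (fun z => ∫ t in a..b, g t / (γ t - z)) (γ '' Icc a b)ᶜ := by
  intro z₀ hz₀
  have hclosed : IsClosed (γ '' Icc a b) := (isCompact_Icc.image_of_continuousOn hγ).isClosed
  obtain ⟨ε, hε, hball⟩ := Metric.isOpen_iff.1 hclosed.isOpen_compl z₀ hz₀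
  obtain ⟨M, hM⟩ := isCompact_Icc.exists_bound_of_continuousOn hg
  have hdist : ∀ t ∈ Icc a b, ∀ z ∈ Metric.ball z₀ (ε / 2), ε / 2 ≤ ‖γ t - z‖ := by
    intro t ht z hz
    have h₁ : ε ≤ dist (γ t) z₀ := by
      by_contra! h
      exact hball (Metric.mem_ball.2 h) (mem_image_of_mem γ ht)
    have h₂ := dist_triangle (γ t) z z₀
    rw [Metric.mem_ball] at hz
    rw [← dist_eq]
    linarith
  have hne : ∀ t ∈ Icc a b, ∀ z ∈ Metric.ball z₀ (ε / 2), γ t - z ≠ 0 := fun t ht z hz =>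
    norm_pos_iff.1 ((half_pos hε).trans_le (hdist t ht z hz))
  have hmem : z₀ ∈ Metric.ball z₀ (ε / 2) := Metric.mem_ball_self (half_pos hε)
  have hnhds : Metric.ball z₀ (ε / 2) ∈ 𝓝 z₀ := Metric.ball_mem_nhds _ (half_pos hε)
  have hF : ∀ z ∈ Metric.ball z₀ (ε / 2),
      ContinuousOn (fun t => g t / (γ t - z)) (Icc a b) := fun z hz =>
    hg.div (hγ.sub continuousOn_const) fun t ht => hne t ht z hz
  have hF' : ContinuousOn (fun t => g t / (γ t - z₀) ^ 2) (Icc a b) :=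
    hg.div ((hγ.sub continuousOn_const).pow 2) fun t ht => pow_ne_zero 2 (hne t ht z₀ hmem)
  have hsubset : uIoc a b ⊆ Icc a b := by
    rw [uIoc_of_le hab]
    exact Ioc_subset_Icc_self
  refine ((intervalIntegral.hasDerivAt_integral_of_dominated_loc_of_deriv_le
    (F := fun z t => g t / (γ t - z)) (F' := fun z t => g t / (γ t - z) ^ 2)
    (bound := fun _ => M / (ε / 2) ^ 2) hnhds ?_ ?_ ?_ ?_ ?_
    ?_).2.differentiableAt).differentiableWithinAt
  · filter_upwards [hnhds] with z hz
    exact ((hF z hz).mono hsubset).aestronglyMeasurable measurableSet_uIoc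
  · exact (hF z₀ hmem).intervalIntegrable_of_Icc hab
  · exact (hF'.mono hsubset).aestronglyMeasurable measurableSet_uIoc
  · refine Eventually.of_forall fun t ht z hz => ?_
    have h₁ := hM t (hsubset ht)
    rw [norm_div, norm_pow]
    have h₂ := hdist t (hsubset ht) z hz
    have h₃ := (norm_nonneg _).trans h₁
    gcongr
  · exact intervalIntegrable_const
  · refine Eventually.of_forall fun t ht z hz => ?_
    have h := (hasDerivAt_const z (g t)).div ((hasDerivAt_id z).const_sub (γ t))
      (hne t (hsubset ht) z hz)
    exact h.congr_deriv (by simp)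

theorem tendsto_integral_div_sub_cobounded {γ g : ℝ → ℂ} {a b : ℝ} (hab : a ≤ b)
    (hγ : ContinuousOn γ (Icc a b)) (hg : ContinuousOn g (Icc a b)) :
    Tendsto (fun z => ∫ t in a..b, g t / (γ t - z)) (cobounded ℂ) (𝓝 0) := by
  obtain ⟨M, hM⟩ := isCompact_Icc.exists_bound_of_continuousOn hg
  obtain ⟨R, hR⟩ := isCompact_Icc.exists_bound_of_continuousOn hγ
  have hlim : Tendsto (fun z : ℂ => M / (‖z‖ - R) * |b - a|) (cobounded ℂ) (𝓝 0) := by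
    have h : Tendsto (fun z : ℂ => ‖z‖ - R) (cobounded ℂ) atTop :=
      tendsto_atTop_add_const_right _ (-R) tendsto_norm_cobounded_atTop
    simpa using (h.const_div_atTop M).mul_const |b - a|
  refine squeeze_zero_norm' ?_ hlim
  filter_upwards [tendsto_norm_cobounded_atTop.eventually_gt_atTop R] with z hz
  refine intervalIntegral.norm_integral_le_of_norm_le_const fun t ht => ?_
  have ht' : t ∈ Icc a b := by
    rw [uIoc_of_le hab] at ht
    exact Ioc_subset_Icc_self ht
  have h₁ := hM t ht'
  have h₂ := hR t ht'
  have h₃ : ‖z‖ - R ≤ ‖γ t - z‖ := by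
    have := norm_sub_norm_le z (γ t)
    rw [norm_sub_rev] at this
    linarith
  have h₄ := (norm_nonneg _).trans h₁
  rw [norm_div]
  have h₅ : 0 < ‖z‖ - R := sub_pos.2 hz
  gcongr

theorem exists_sqrt_sq_sub_one_of_path {γ g : ℝ → ℂ}
    (hγ : ∀ t ∈ Icc (-1 : ℝ) 1, HasDerivAt γ (g t) t) (hg : ContinuousOn g (Icc (-1) 1))
    (h₁ : γ (-1) = -1) (h₂ : γ 1 = 1) :
    ∃ w : ℂ → ℂ, DifferentiableOn ℂ w (γ '' Icc (-1) 1)ᶜ ∧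
      (∀ z ∈ (γ '' Icc (-1) 1)ᶜ, w z ^ 2 = z ^ 2 - 1) ∧
      Tendsto (fun z => w z / z) (cobounded ℂ) (𝓝 1) := by
  have hab : (-1 : ℝ) ≤ 1 := by norm_num
  have hγc : ContinuousOn γ (Icc (-1) 1) := fun t ht => (hγ t ht).continuousAt.continuousWithinAt
  refine ⟨fun z => (z + 1) * exp ((∫ t in (-1 : ℝ)..1, g t / (γ t - z)) / 2), ?_, ?_, ?_⟩
  · exact (differentiableOn_id.add_const 1).mul
      ((differentiableOn_integral_div_sub hab hγc hg).div_const 2).cexp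
  · intro z hz
    have h := exp_integral_div_sub hab hγ hg (z := z) fun t ht he => hz ⟨t, ht, he⟩
    rw [h₁, h₂] at h
    rw [mul_pow, ← exp_nat_mul, Nat.cast_ofNat, mul_div_cancel₀ _ (two_ne_zero' ℂ)]
    linear_combination (-(z + 1)) * h
  · have hexp : Tendsto (fun z => exp ((∫ t in (-1 : ℝ)..1, g t / (γ t - z)) / 2))
        (cobounded ℂ) (𝓝 1) := by
      have h := ((tendsto_integral_div_sub_cobounded hab hγc hg).div_const 2).cexp
      simpa using h
    have hinv : Tendsto (fun z : ℂ => 1 + z⁻¹) (cobounded ℂ) (𝓝 1) := by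
      simpa using tendsto_inv₀_cobounded.const_add (1 : ℂ)
    have hlim := hinv.mul hexp
    rw [mul_one] at hlim
    refine hlim.congr' ?_
    filter_upwards [eventually_ne_cobounded (0 : ℂ)] with z hz
    field_simp

theorem eqOn_of_sq_eq_of_tendsto_div {V : Set ℂ} (hV : IsPreconnected V) (hVc : V ∈ cobounded ℂ)
    {w w' : ℂ → ℂ} (hw : ContinuousOn w V) (hw' : ContinuousOn w' V)
    (hsq : ∀ z ∈ V, w' z ^ 2 = w z ^ 2) (hne : ∀ z ∈ V, w z ≠ 0)
    (hlim : Tendsto (fun z => w z / z) (cobounded ℂ) (𝓝 1))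
    (hlim' : Tendsto (fun z => w' z / z) (cobounded ℂ) (𝓝 1)) : EqOn w' w V := by
  refine (hV.eq_or_eq_neg_of_sq_eq hw' hw hsq (hne _)).resolve_right fun h => ?_
  have hneg : Tendsto (fun z => w' z / z) (cobounded ℂ) (𝓝 (-1)) := by
    refine hlim.neg.congr' ?_
    filter_upwards [hVc] with z hz
    rw [h hz, Pi.neg_apply, neg_div]
  have := tendsto_nhds_unique hlim' hneg
  norm_num at this


theorem stmt_16 (U : Set ℂ) (hU : IsOpen U) (hsub : seg ⊆ U)
    (p : ℂ → ℂ) (hpdiff : DifferentiableOn ℂ p U) (hpinj : Set.InjOn p U)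
    (hpm1 : p (-1) = -1) (hp1 : p 1 = 1) :
    IsOpen (p '' seg)ᶜ ∧ IsConnected (p '' seg)ᶜ ∧
    ∃ w : ℂ → ℂ,
      (DifferentiableOn ℂ w (p '' seg)ᶜ ∧
        (∀ z ∈ (p '' seg)ᶜ, w z ^ 2 = z ^ 2 - 1) ∧
        Tendsto (fun z => w z / z) (cobounded ℂ) (𝓝 1)) ∧
      ∀ w' : ℂ → ℂ,
        (DifferentiableOn ℂ w' (p '' seg)ᶜ ∧
          (∀ z ∈ (p '' seg)ᶜ, w' z ^ 2 = z ^ 2 - 1) ∧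
          Tendsto (fun z => w' z / z) (cobounded ℂ) (𝓝 1)) →
        Set.EqOn w' w (p '' seg)ᶜ := by
  have hpseg : ContinuousOn p seg := hpdiff.continuousOn.mono hsub
  have hcompact : IsCompact (p '' seg) := isCompact_seg.image_of_continuousOn hpseg
  have hconn := isConnected_compl_image_seg hU hsub hpdiff hpinj
  refine ⟨hcompact.isClosed.isOpen_compl, hconn, ?_⟩
  have hmem : ∀ t ∈ Icc (-1 : ℝ) 1, (t : ℂ) ∈ U := fun t ht => hsub ⟨t, ht, rfl⟩
  have hderiv : ∀ t ∈ Icc (-1 : ℝ) 1,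
      HasDerivAt (fun t : ℝ => p t) (deriv p (t : ℂ)) t := fun t ht =>
    (hpdiff.differentiableAt (hU.mem_nhds (hmem t ht))).hasDerivAt.comp_ofReal
  have hcont : ContinuousOn (fun t : ℝ => deriv p (t : ℂ)) (Icc (-1) 1) :=
    (hpdiff.deriv hU).continuousOn.comp continuous_ofReal.continuousOn hmem
  obtain ⟨w, hw, hwsq, hwlim⟩ := exists_sqrt_sq_sub_one_of_path hderiv hcont
    (by simpa using hpm1) (by simpa using hp1)
  have himage : (fun t : ℝ => p t) '' Icc (-1) 1 = p '' seg := by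
    rw [seg, image_image]
  rw [himage] at hw hwsq
  refine ⟨w, ⟨hw, hwsq, hwlim⟩, ?_⟩
  rintro w' ⟨hw', hwsq', hwlim'⟩
  refine eqOn_of_sq_eq_of_tendsto_div hconn.isPreconnected
    (isBounded_def.1 hcompact.isBounded) hw.continuousOn hw'.continuousOn
    (fun z hz => (hwsq' z hz).trans (hwsq z hz).symm) (fun z hz h₀ => hz ?_) hwlim hwlim'
  have h := hwsq z hz
  rw [h₀] at h
  have hz1 : (z - 1) * (z + 1) = 0 := by linear_combination -h
  rcases mul_eq_zero.1 hz1 with h | h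
  · exact ⟨1, one_mem_seg, hp1.trans (sub_eq_zero.1 h).symm⟩
  · exact ⟨-1, neg_one_mem_seg, hpm1.trans (eq_neg_of_add_eq_zero_left h).symm⟩
end
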